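/- Let A₁, …, A_N be n×n positive definite complex matrices, let ω = (w₁, …, w_N) be a positive probability vector, let 0 ≤ t < z ≤ 1, and suppose the positive definite matrix X satisfies the Rényi power mean equation X = Σⱼ wⱼ (Aⱼ^{(1-t)/(2z)} X^{t/z} Aⱼ^{(1-t)/(2z)})^z. If X ≥ I in the Loewner order, then Q_{1-t}(ω; A₁, …, A_N) = (Σⱼ wⱼ Aⱼ^{1-t})^{1/(1-t)} ⪯ X^{1/(1-t)} in the near-order. -/

import Mathlib

open Matrix
open scoped ComplexOrder

/-- Real power of a matrix via functional calculus on the spectrum (junk value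
if the matrix is not Hermitian). -/
noncomputable def mrpow {n : ℕ} (A : Matrix (Fin n) (Fin n) ℂ) (r : ℝ) :
    Matrix (Fin n) (Fin n) ℂ :=
  if hA : A.IsHermitian then
    (hA.eigenvectorUnitary : Matrix (Fin n) (Fin n) ℂ) *
      diagonal (fun i => ((hA.eigenvalues i ^ r : ℝ) : ℂ)) *
      (star (hA.eigenvectorUnitary : Matrix (Fin n) (Fin n) ℂ))
  else A

/-- The metric geometric mean `A # B = A^{1/2} (A^{-1/2} B A^{-1/2})^{1/2} A^{1/2}`. -/
noncomputable def sharp {n : ℕ} (A B : Matrix (Fin n) (Fin n) ℂ) :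
    Matrix (Fin n) (Fin n) ℂ :=
  mrpow A (1/2) * mrpow (mrpow A (-(1/2)) * B * mrpow A (-(1/2))) (1/2) * mrpow A (1/2)

/-- The Loewner order `A ≤ B`, i.e. `B - A` is positive semidefinite. -/
def loewnerLE {n : ℕ} (A B : Matrix (Fin n) (Fin n) ℂ) : Prop := (B - A).PosSemidef

/-- The near-order `A ⪯ B`, i.e. `A⁻¹ # B ≥ I` in the Loewner order. -/
def nearLE {n : ℕ} (A B : Matrix (Fin n) (Fin n) ℂ) : Prop := loewnerLE 1 (sharp A⁻¹ B)

/-- The quasi-arithmetic mean `Q_p(ω; A₁, …, A_N) = (Σⱼ wⱼ Aⱼ^p)^{1/p}`. -/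
noncomputable def quasiArith {n N : ℕ} (w : Fin N → ℝ) (p : ℝ)
    (A : Fin N → Matrix (Fin n) (Fin n) ℂ) : Matrix (Fin n) (Fin n) ℂ :=
  mrpow (∑ j, w j • mrpow (A j) p) (1/p)

section abstractPart

variable {E : Type*} [CStarAlgebra E] [PartialOrder E] [StarOrderedRing E]

/-- The geometric mean of `P⁻¹` and `Y`. -/
noncomputable def gm (P Y : E) : E :=
  P ^ (-(1/2) : ℝ) * (P ^ (1/2 : ℝ) * Y * P ^ (1/2 : ℝ)) ^ (1/2 : ℝ) * P ^ (-(1/2) : ℝ)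

lemma conj_mono {a b c : E} (hc : 0 ≤ c) (h : a ≤ b) : c * a * c ≤ c * b * c := by
  have hs : IsSelfAdjoint c := IsSelfAdjoint.of_nonneg hc
  have := star_left_conjugate_le_conjugate h c
  rwa [hs.star_eq] at this

lemma conj_nn {a c : E} (hc : 0 ≤ c) (h : 0 ≤ a) : 0 ≤ c * a * c := by
  simpa using conj_mono hc h

lemma half_mul_half {P : E} (hP : 0 ≤ P) : P ^ (1/2 : ℝ) * P ^ (1/2 : ℝ) = P := by
  rw [← CFC.sqrt_eq_rpow, CFC.sqrt_mul_sqrt_self P hP]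

lemma gm_nonneg (P Y : E) : 0 ≤ gm P Y :=
  conj_nn CFC.rpow_nonneg CFC.rpow_nonneg

lemma gm_mul {P Y : E} (hP : IsStrictlyPositive P) (hY : 0 ≤ Y) :
    gm P Y * P * gm P Y = Y := by
  unfold gm
  have hZ : 0 ≤ P ^ (1/2 : ℝ) * Y * P ^ (1/2 : ℝ) := conj_nn CFC.rpow_nonneg hY
  have h0 := half_mul_half hP.nonneg
  have h1 := CFC.rpow_mul_rpow_neg (1/2 : ℝ) hP
  have h2 := CFC.rpow_neg_mul_rpow (1/2 : ℝ) hP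
  have h3 := half_mul_half hZ
  generalize P ^ (1/2 : ℝ) = s at *
  generalize P ^ (-(1/2) : ℝ) = u at *
  generalize (s * Y * s) ^ (1/2 : ℝ) = v at *
  calc u * v * u * P * (u * v * u) = u * v * ((u * s) * (s * u)) * v * u := by
        rw [← h0]; noncomm_ring
    _ = u * (v * v) * u := by rw [h1, h2]; noncomm_ring
    _ = (u * s) * Y * (s * u) := by rw [h3]; noncomm_ring
    _ = Y := by rw [h1, h2]; simp

lemma le_gm {P Y G : E} (hP : IsStrictlyPositive P) (hG : 0 ≤ G) (h : G * P * G ≤ Y) :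
    G ≤ gm P Y := by
  unfold gm
  have hs : 0 ≤ P ^ (1/2 : ℝ) := CFC.rpow_nonneg
  have hu : 0 ≤ P ^ (-(1/2) : ℝ) := CFC.rpow_nonneg
  have h0 := half_mul_half hP.nonneg
  have h1 := CFC.rpow_mul_rpow_neg (1/2 : ℝ) hP
  have h2 := CFC.rpow_neg_mul_rpow (1/2 : ℝ) hP
  generalize P ^ (1/2 : ℝ) = s at *
  generalize P ^ (-(1/2) : ℝ) = u at *
  have hW : 0 ≤ s * G * s := conj_nn hs hG
  have h4 : (s * G * s) * (s * G * s) ≤ s * Y * s := by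
    have := conj_mono hs h
    rw [← h0] at this
    convert this using 1
    noncomm_ring
  have h5 := CFC.sqrt_le_sqrt _ _ h4
  rw [CFC.sqrt_mul_self _ hW, CFC.sqrt_eq_rpow] at h5
  have h6 := conj_mono hu h5
  have h7 : u * (s * G * s) * u = G := by
    calc u * (s * G * s) * u = (u * s) * G * (s * u) := by noncomm_ring
      _ = G := by rw [h1, h2]; simp
  rwa [h7] at h6

lemma one_le_gm_double {P Y : E} (hP : IsStrictlyPositive P) (hP2 : IsStrictlyPositive (P * P))
    (hY : 0 ≤ Y) (h : 1 ≤ gm P Y) : 1 ≤ gm (P * P) (Y * Y) := by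
  have hG := gm_nonneg P Y
  have hm := gm_mul hP hY
  generalize gm P Y = G at *
  refine h.trans (le_gm hP2 hG ?_)
  have h1 : (1 : E) ≤ G * G := by
    have h2 : G ^ (1/2 : ℝ) * 1 * G ^ (1/2 : ℝ) ≤ G ^ (1/2 : ℝ) * G * G ^ (1/2 : ℝ) :=
      conj_mono CFC.rpow_nonneg h
    have h3 := half_mul_half hG
    generalize G ^ (1/2 : ℝ) = g at *
    have h4 : g * G * g = G * G := by rw [← h3]; noncomm_ring
    rw [mul_one, h3, h4] at h2
    exact h.trans h2
  have h2 := conj_mono hG (conj_mono hP.nonneg h1)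
  calc G * (P * P) * G = G * (P * 1 * P) * G := by simp
    _ ≤ _ := h2
    _ = (G * P * G) * (G * P * G) := by noncomm_ring
    _ = _ := by rw [hm]

lemma spos_rpow {S : E} (hS : IsStrictlyPositive S) (r : ℝ) : IsStrictlyPositive (S ^ r) :=
  IsStrictlyPositive.iff_of_unital.mpr ⟨CFC.rpow_nonneg, hS.isUnit.cfcRpow r hS.nonneg⟩

lemma one_le_gm_rpow {S X : E} (hS : IsStrictlyPositive S) (hX : IsStrictlyPositive X)
    (h : S ≤ X) (k : ℕ) : ∀ r : ℝ, 0 ≤ r → r ≤ 2 ^ k → 1 ≤ gm (S ^ r) (X ^ r) := by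
  induction k with
  | zero =>
    intro r h0 h1
    refine le_gm (spos_rpow hS r) zero_le_one ?_
    simpa using CFC.rpow_le_rpow ⟨h0, by simpa using h1⟩ h
  | succ k ih =>
    intro r h0 h1
    have h2 := ih (r / 2) (by positivity) (by rw [pow_succ] at h1; linarith)
    have h3 : ∀ T : E, IsStrictlyPositive T → T ^ (r / 2) * T ^ (r / 2) = T ^ r := by
      intro T hT
      rw [← CFC.rpow_add hT.isUnit, add_halves]
    have := one_le_gm_double (spos_rpow hS _) (by rw [h3 S hS]; exact spos_rpow hS r)
      CFC.rpow_nonneg h2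
    rwa [h3 S hS, h3 X hX] at this

end abstractPart

section matrixPart

open scoped Matrix.Norms.L2Operator MatrixOrder

lemma mrpow_eq {n : ℕ} {A : Matrix (Fin n) (Fin n) ℂ} (hA : 0 ≤ A) (r : ℝ) :
    mrpow A r = A ^ r := by
  have hH : A.IsHermitian := (nonneg_iff_posSemidef.mp hA).isHermitian
  rw [CFC.rpow_eq_cfc_real hA, hH.cfc_eq, Matrix.IsHermitian.cfc, Unitary.conjStarAlgAut_apply,
    mrpow, dif_pos hH]
  rfl

lemma renyi_ge {n N : ℕ}
    (A : Fin N → Matrix (Fin n) (Fin n) ℂ) (hA : ∀ j, (A j).PosDef)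
    (w : Fin N → ℝ) (hw : ∀ j, 0 < w j)
    (t z : ℝ) (ht0 : 0 ≤ t) (htz : t < z) (hz1 : z ≤ 1)
    (X : Matrix (Fin n) (Fin n) ℂ) (hX : X.PosDef)
    (hfix : X = ∑ j, w j •
      mrpow (mrpow (A j) ((1 - t) / (2 * z)) * mrpow X (t / z) *
        mrpow (A j) ((1 - t) / (2 * z))) z)
    (h1X : 1 ≤ X) : ∑ j, w j • mrpow (A j) (1 - t) ≤ X := by
  have hz : 0 < z := ht0.trans_lt htz
  have hX0 : 0 ≤ X := (isStrictlyPositive_iff_posDef.mpr hX).nonneg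
  have hXt : 1 ≤ X ^ (t / z) := by
    have := CFC.rpow_le_rpow (p := t / z) ⟨by positivity, by rw [div_le_one hz]; exact htz.le⟩ h1X
    simpa using this
  conv_rhs => rw [hfix]
  refine Finset.sum_le_sum fun j _ => ?_
  refine smul_le_smul_of_nonneg_left ?_ (hw j).le
  have hs := isStrictlyPositive_iff_posDef.mpr (hA j)
  have hA0 : 0 ≤ A j := hs.nonneg
  rw [mrpow_eq hX0, mrpow_eq hA0, mrpow_eq hA0]
  rw [mrpow_eq (conj_nn CFC.rpow_nonneg CFC.rpow_nonneg)]
  have h1 := conj_mono (c := A j ^ ((1 - t) / (2 * z))) CFC.rpow_nonneg hXt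
  rw [mul_one, ← CFC.rpow_add hs.isUnit] at h1
  have h2 := CFC.rpow_le_rpow (p := z) ⟨hz.le, hz1⟩ h1
  have h3 : (1 - t) / (2 * z) + (1 - t) / (2 * z) ≠ 0 := by
    have : 0 < 1 - t := by linarith
    positivity
  rw [CFC.rpow_rpow _ _ _ h3 hs] at h2
  convert h2 using 2
  field_simp
  ring

lemma sharp_inv_eq {n : ℕ} {Q B : Matrix (Fin n) (Fin n) ℂ} (hQ : IsStrictlyPositive Q)
    (hB : 0 ≤ B) : sharp Q⁻¹ B = gm Q B := by
  have h : Q⁻¹ = Q ^ (-1 : ℝ) := by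
    rw [← CFC.inverse_eq_rpow_neg_one hQ, Matrix.nonsing_inv_eq_ringInverse]
  have h0 : 0 ≤ Q⁻¹ := h ▸ CFC.rpow_nonneg
  rw [sharp, gm, mrpow_eq h0, mrpow_eq h0, mrpow_eq (conj_nn CFC.rpow_nonneg hB), h,
    CFC.rpow_rpow _ _ _ (by norm_num) hQ, CFC.rpow_rpow _ _ _ (by norm_num) hQ]
  norm_num

lemma near_final {n : ℕ} {S X : Matrix (Fin n) (Fin n) ℂ} (hS : IsStrictlyPositive S)
    (hX : IsStrictlyPositive X) (h : S ≤ X) (r : ℝ) (hr : 0 ≤ r) :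
    nearLE (mrpow S r) (mrpow X r) := by
  rw [nearLE, loewnerLE, ← Matrix.le_iff, mrpow_eq hS.nonneg, mrpow_eq hX.nonneg,
    sharp_inv_eq (spos_rpow hS r) CFC.rpow_nonneg]
  obtain ⟨k, hk⟩ := pow_unbounded_of_one_lt r (by norm_num : (1 : ℝ) < 2)
  exact one_le_gm_rpow hS hX h k r hr hk.le

lemma sum_spos {n N : ℕ}
    (A : Fin N → Matrix (Fin n) (Fin n) ℂ) (hA : ∀ j, (A j).PosDef)
    (w : Fin N → ℝ) (hw : ∀ j, 0 < w j) (hw1 : ∑ j, w j = 1) (p : ℝ) :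
    IsStrictlyPositive (∑ j, w j • mrpow (A j) p) := by
  have hne : (Finset.univ : Finset (Fin N)).Nonempty := by
    by_contra hc
    rw [Finset.not_nonempty_iff_eq_empty] at hc
    simp [hc] at hw1
  rw [isStrictlyPositive_iff_posDef]
  refine Matrix.posDef_sum hne fun j _ => ?_
  have hs := isStrictlyPositive_iff_posDef.mpr (hA j)
  rw [mrpow_eq hs.nonneg]
  exact (isStrictlyPositive_iff_posDef.mp (spos_rpow hs p)).smul (hw j)

end matrixPart

theorem quasiArith_nearLE_renyi_of_one_le {n N : ℕ}
    (A : Fin N → Matrix (Fin n) (Fin n) ℂ) (hA : ∀ j, (A j).PosDef)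
    (w : Fin N → ℝ) (hw : ∀ j, 0 < w j) (hw1 : ∑ j, w j = 1)
    (t z : ℝ) (ht0 : 0 ≤ t) (htz : t < z) (hz1 : z ≤ 1)
    (X : Matrix (Fin n) (Fin n) ℂ) (hX : X.PosDef)
    (hfix : X = ∑ j, w j •
      mrpow (mrpow (A j) ((1 - t) / (2 * z)) * mrpow X (t / z) *
        mrpow (A j) ((1 - t) / (2 * z))) z)
    (h1X : loewnerLE 1 X) :
    nearLE (quasiArith w (1 - t) A) (mrpow X (1 / (1 - t))) := by
  have hS := sum_spos A hA w hw hw1 (1 - t)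
  have hle := renyi_ge A hA w hw t z ht0 htz hz1 X hX hfix h1X
  exact near_final hS (isStrictlyPositive_iff_posDef.mpr hX) hle _
    (one_div_nonneg.mpr (by linarith))
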